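/- arXiv:2412.15996 — 2 statements merged into one kernel-verified Lean document; each statement's English description precedes it below -/
import Mathlib

section
/- Let n ≥ 1. For X ∈ ℝ^{1,n}, let ξ_X : ℝ^n → ℝ × ℝ^n be the cut of Ti determined by X, namely ξ_X(y) = ( −η(X, P̃(y)), y ). Then the Poincaré action on Ti maps cuts to cuts equivariantly: for every (Λ,T) in the orthochronous Poincaré group and every y ∈ ℝ^n, (Λ,T)·ξ_X(y) = ξ_{T + ΛX}(φ_Λ(y)). In particular, the image of the cut of X under (Λ,T) is the cut of the transformed spacetime point T + ΛX. -/
open scoped BigOperators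
open Filter MeasureTheory
open scoped Matrix

noncomputable section

/-- Minkowski inner product on `ℝ^{1,n}` (mostly plus signature). -/
def minkowski (n : ℕ) (X Y : Fin (n+1) → ℝ) : ℝ :=
  -(X 0 * Y 0) + ∑ i : Fin n, X i.succ * Y i.succ

/-- Parametrization of the future unit hyperboloid `H^n ⊂ ℝ^{1,n}`. -/
def hyp (n : ℕ) (y : Fin n → ℝ) : Fin (n+1) → ℝ :=
  Fin.cons (Real.sqrt (1 + ∑ i, y i ^ 2)) y

/-- The Minkowski metric as a matrix, `η = diag(-1, 1, …, 1)`. -/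
def etaMat (n : ℕ) : Matrix (Fin (n+1)) (Fin (n+1)) ℝ :=
  Matrix.diagonal (fun i => if i = 0 then (-1 : ℝ) else 1)

/-- An orthochronous Lorentz transformation: `Λᵀ η Λ = η` and `Λ⁰⁰ > 0`. -/
def IsOrthochronousLorentz (n : ℕ) (Λ : Matrix (Fin (n+1)) (Fin (n+1)) ℝ) : Prop :=
  Λᵀ * etaMat n * Λ = etaMat n ∧ 0 < Λ 0 0

/-- The map `φ_Λ` induced by a Lorentz transformation on the hyperboloid chart. -/
def lorentzBdy (n : ℕ) (Λ : Matrix (Fin (n+1)) (Fin (n+1)) ℝ) (y : Fin n → ℝ) : Fin n → ℝ :=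
  fun i => Λ.mulVec (hyp n y) i.succ

/-- The Poincaré action on `Ti ≅ ℝ × ℝⁿ`. -/
def poincAct (n : ℕ) (Λ : Matrix (Fin (n+1)) (Fin (n+1)) ℝ) (T : Fin (n+1) → ℝ)
    (p : ℝ × (Fin n → ℝ)) : ℝ × (Fin n → ℝ) :=
  (p.1 - minkowski n T (hyp n (lorentzBdy n Λ p.2)), lorentzBdy n Λ p.2)

/-- The cut of `Ti` determined by a spacetime point `X`: `ξ_X(y) = (-η(X,P̃(y)), y)`. -/
def tiCut (n : ℕ) (X : Fin (n+1) → ℝ) (y : Fin n → ℝ) : ℝ × (Fin n → ℝ) :=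
  (-(minkowski n X (hyp n y)), y)

theorem etaMat_mul_self (n : ℕ) : etaMat n * etaMat n = 1 := by
  rw [etaMat, Matrix.diagonal_mul_diagonal, ← Matrix.diagonal_one]
  congr 1
  funext i
  split_ifs <;> norm_num

theorem minkowski_eq_dotProduct (n : ℕ) (X Y : Fin (n+1) → ℝ) :
    minkowski n X Y = X ⬝ᵥ (etaMat n *ᵥ Y) := by
  simp [minkowski, etaMat, dotProduct, Fin.sum_univ_succ, Matrix.mulVec_diagonal]

theorem minkowski_add_left (n : ℕ) (X Y Z : Fin (n+1) → ℝ) :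
    minkowski n (X + Y) Z = minkowski n X Z + minkowski n Y Z := by
  simp only [minkowski_eq_dotProduct, add_dotProduct]

theorem minkowski_hyp_self (n : ℕ) (y : Fin n → ℝ) :
    minkowski n (hyp n y) (hyp n y) = -1 := by
  have h : (0 : ℝ) ≤ 1 + ∑ i, y i ^ 2 := by positivity
  simp [minkowski, hyp, Real.mul_self_sqrt h, ← pow_two]

namespace IsOrthochronousLorentz

variable {n : ℕ} {Λ : Matrix (Fin (n+1)) (Fin (n+1)) ℝ}

theorem minkowski_mulVec (hΛ : IsOrthochronousLorentz n Λ) (X Y : Fin (n+1) → ℝ) :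
    minkowski n (Λ *ᵥ X) (Λ *ᵥ Y) = minkowski n X Y := by
  rw [minkowski_eq_dotProduct, minkowski_eq_dotProduct, ← Matrix.vecMul_transpose,
    ← Matrix.dotProduct_mulVec]
  conv_rhs => rw [← hΛ.1]
  simp only [Matrix.mulVec_mulVec, Matrix.mul_assoc]

theorem transpose (hΛ : IsOrthochronousLorentz n Λ) : IsOrthochronousLorentz n Λᵀ := by
  refine ⟨?_, hΛ.2⟩
  have hleft : (etaMat n * Λᵀ * etaMat n) * Λ = 1 := by
    rw [Matrix.mul_assoc, Matrix.mul_assoc, ← Matrix.mul_assoc Λᵀ, hΛ.1, etaMat_mul_self]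
  have hright : Λ * (etaMat n * Λᵀ * etaMat n) = 1 := mul_eq_one_comm.mp hleft
  calc Λᵀᵀ * etaMat n * Λᵀ
      = Λ * (etaMat n * Λᵀ * etaMat n) * etaMat n := by
        simp only [Matrix.transpose_transpose, Matrix.mul_assoc, etaMat_mul_self, Matrix.mul_one]
    _ = etaMat n := by rw [hright, Matrix.one_mul]

theorem sq_zero_zero (hΛ : IsOrthochronousLorentz n Λ) :
    Λ 0 0 ^ 2 = 1 + ∑ i : Fin n, Λ 0 i.succ ^ 2 := by
  have h := hΛ.transpose.minkowski_mulVec (Pi.single 0 1) (Pi.single 0 1)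
  simp [minkowski] at h
  simp only [pow_two]
  linarith

theorem mulVec_hyp_zero_pos (hΛ : IsOrthochronousLorentz n Λ) (y : Fin n → ℝ) :
    0 < (Λ *ᵥ hyp n y) 0 := by
  have hy : (0 : ℝ) ≤ ∑ i, y i ^ 2 := by positivity
  have hrow : (0 : ℝ) ≤ ∑ i : Fin n, Λ 0 i.succ ^ 2 := by positivity
  have hcs := Finset.sum_mul_sq_le_sq_mul_sq Finset.univ (fun i : Fin n => Λ 0 i.succ) y
  have hlt : |∑ i : Fin n, Λ 0 i.succ * y i| < Λ 0 0 * √(1 + ∑ i, y i ^ 2) := by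
    apply abs_lt_of_sq_lt_sq
    · rw [mul_pow, hΛ.sq_zero_zero, Real.sq_sqrt (by linarith)]
      nlinarith
    · exact mul_nonneg hΛ.2.le (Real.sqrt_nonneg _)
  have := (abs_lt.mp hlt).1
  simp only [Matrix.mulVec, dotProduct, Fin.sum_univ_succ, hyp, Fin.cons_zero, Fin.cons_succ]
  linarith

theorem hyp_lorentzBdy (hΛ : IsOrthochronousLorentz n Λ) (y : Fin n → ℝ) :
    hyp n (lorentzBdy n Λ y) = Λ *ᵥ hyp n y := by
  funext i
  refine Fin.cases ?_ (fun j => rfl) i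
  have h := hΛ.minkowski_mulVec (hyp n y) (hyp n y)
  rw [minkowski_hyp_self, minkowski] at h
  simp only [← pow_two] at h
  change √(1 + ∑ i : Fin n, (Λ *ᵥ hyp n y) i.succ ^ 2) = _
  rw [Real.sqrt_eq_iff_mul_self_eq_of_pos (hΛ.mulVec_hyp_zero_pos y), ← pow_two]
  linarith

end IsOrthochronousLorentz

/-- The Poincaré action on `Ti` maps cuts to cuts equivariantly:
`(Λ,T)·ξ_X(y) = ξ_{T+ΛX}(φ_Λ(y))`. -/
theorem poincare_action_maps_cuts_to_cuts
    (n : ℕ) (hn : 1 ≤ n) (X : Fin (n+1) → ℝ)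
    (Λ : Matrix (Fin (n+1)) (Fin (n+1)) ℝ) (T : Fin (n+1) → ℝ)
    (hΛ : IsOrthochronousLorentz n Λ) (y : Fin n → ℝ) :
    poincAct n Λ T (tiCut n X y) = tiCut n (T + Λ.mulVec X) (lorentzBdy n Λ y) := by
  refine Prod.ext ?_ rfl
  simp only [poincAct, tiCut]
  rw [minkowski_add_left, hΛ.hyp_lorentzBdy, hΛ.minkowski_mulVec]
  ring
end
end

section
/- Let n ≥ 1, Λ ∈ ℝ, and let h_{αβ} : ℝ^n → ℝ^{n×n} be a smooth family of invertible symmetric matrices whose Riemann curvature satisfies the constant-curvature condition R^{(h)α}{}_{βγδ} = 2Λ ( δ^α_γ h_{δβ} − δ^α_δ h_{γβ} ). On ℝ × ℝ^n with coordinates (u, y), define connection coefficients: Γ^α_{βγ} = Levi-Civita Christoffels of h_{αβ}, Γ^u_{βγ}(u,y) = 2Λ u h_{βγ}(y), and all other components zero. Then the curvature R^a{}_{bcd} = ∂_c Γ^a_{db} − ∂_d Γ^a_{cb} + Σ_e ( Γ^a_{ce} Γ^e_{db} − Γ^a_{de} Γ^e_{cb} ) of this connection satisfies R^a{}_{bcd}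 = 2Λ ( δ^a_c h_{db} − δ^a_d h_{cb} ) for all indices a,b,c,d ∈ {u,1,…,n}, where h_{ab} is the degenerate extension of h_{αβ} (h_{uu} = h_{uα} = 0). In other words, the flat Carroll(–(A)dS) model connection has constant Carrollian curvature. -/
open scoped BigOperators
open Filter MeasureTheory

noncomputable section

/-- Partial derivative in the `i`-th coordinate direction. -/
def pdv {m : ℕ} {F : Type*} [NormedAddCommGroup F] [NormedSpace ℝ F]
    (i : Fin m) (f : (Fin m → ℝ) → F) (x : Fin m → ℝ) : F :=
  fderiv ℝ f x (Pi.single i 1)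

/-- Extension of a spatial 2-tensor on `ℝⁿ` by zero to adapted coordinates on `ℝ × ℝⁿ`. -/
def spatialExt (n : ℕ) (T : Fin n → Fin n → ℝ) (b c : Fin (n+1)) : ℝ :=
  Fin.cases (motive := fun _ => ℝ) 0
    (fun β => Fin.cases (motive := fun _ => ℝ) 0 (fun γ => T β γ) c) b

/-- The degenerate Carrollian metric `h_{ab}` on `ℝ × ℝⁿ`. -/
def degH (n : ℕ) (hmat : (Fin n → ℝ) → Fin n → Fin n → ℝ)
    (x : Fin (n+1) → ℝ) (a b : Fin (n+1)) : ℝ :=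
  spatialExt n (hmat (x ∘ Fin.succ)) a b

/-- Christoffel symbols `Γ^γ_{αβ}` of a metric `h_{αβ}` on `ℝⁿ` (via the matrix inverse). -/
def ChrG (n : ℕ) (hmat : (Fin n → ℝ) → Fin n → Fin n → ℝ)
    (y : Fin n → ℝ) (γ α β : Fin n) : ℝ :=
  (1/2) * ∑ δ, (Matrix.of (hmat y))⁻¹ γ δ *
    (pdv α (fun y => hmat y δ β) y + pdv β (fun y => hmat y δ α) y
      - pdv δ (fun y => hmat y α β) y)

/-- The Riemann curvature tensor `R^α_{βγδ}` of a metric `h_{αβ}` on `ℝⁿ`. -/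
def Riem (n : ℕ) (hmat : (Fin n → ℝ) → Fin n → Fin n → ℝ)
    (y : Fin n → ℝ) (α β γ δ : Fin n) : ℝ :=
  pdv γ (fun y => ChrG n hmat y α δ β) y - pdv δ (fun y => ChrG n hmat y α γ β) y
    + ∑ ε, (ChrG n hmat y α γ ε * ChrG n hmat y ε δ β
        - ChrG n hmat y α δ ε * ChrG n hmat y ε γ β)

/-- The flat Carroll(–(A)dS) model connection on `ℝ × ℝⁿ`:
`Γ^α_{βγ}` are the Christoffel symbols of `h` and `Γ^u_{βγ} = 2Λu h_{βγ}`;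
all other components vanish.  The first index is the upper one. -/
def Γmodel (n : ℕ) (Λ : ℝ) (hmat : (Fin n → ℝ) → Fin n → Fin n → ℝ)
    (x : Fin (n+1) → ℝ) (a b c : Fin (n+1)) : ℝ :=
  Fin.cases (motive := fun _ => ℝ)
    (spatialExt n (fun β γ => 2 * Λ * x 0 * hmat (x ∘ Fin.succ) β γ) b c)
    (fun α => spatialExt n (fun β γ => ChrG n hmat (x ∘ Fin.succ) α β γ) b c)
    a

/-- The curvature `R^a_{bcd} = ∂_cΓ^a_{db} - ∂_dΓ^a_{cb} + Γ^a_{ce}Γ^e_{db} - Γ^a_{de}Γ^e_{cb}`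
of a connection on `ℝ × ℝⁿ`. -/
def Rfull (n : ℕ) (Γ : (Fin (n+1) → ℝ) → Fin (n+1) → Fin (n+1) → Fin (n+1) → ℝ)
    (x : Fin (n+1) → ℝ) (a b c d : Fin (n+1)) : ℝ :=
  pdv c (fun x => Γ x a d b) x - pdv d (fun x => Γ x a c b) x
    + ∑ e, (Γ x a c e * Γ x e d b - Γ x a d e * Γ x e c b)

/-- Precomposition with the projection `ℝ × ℝⁿ → ℝⁿ` reflects and preserves differentiability. -/
theorem differentiableAt_comp_succ_iff {n : ℕ} (g : (Fin n → ℝ) → ℝ) (x : Fin (n+1) → ℝ) :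
    DifferentiableAt ℝ (fun z : Fin (n+1) → ℝ => g (z ∘ Fin.succ)) x ↔
      DifferentiableAt ℝ g (x ∘ Fin.succ) := by
  constructor
  · intro hg
    have hs : DifferentiableAt ℝ (fun y : Fin n → ℝ => (Fin.cons (x 0) y : Fin (n+1) → ℝ))
        (x ∘ Fin.succ) := by
      rw [differentiableAt_pi]
      intro i
      refine Fin.cases ?_ (fun j => ?_) i
      · simp
      · simpa using differentiableAt_apply j (x ∘ Fin.succ)
    have hx : (Fin.cons (x 0) (x ∘ Fin.succ) : Fin (n+1) → ℝ) = x := Fin.cons_self_tail x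
    have hg' : DifferentiableAt ℝ (fun z : Fin (n+1) → ℝ => g (z ∘ Fin.succ))
        (Fin.cons (x 0) (x ∘ Fin.succ)) := by rwa [hx]
    exact hg'.comp (x ∘ Fin.succ) hs
  · intro hg
    have hp : DifferentiableAt ℝ (fun z : Fin (n+1) → ℝ => z ∘ Fin.succ) x :=
      differentiableAt_pi.2 fun j => differentiableAt_apply (Fin.succ j) x
    exact DifferentiableAt.comp x hg hp

theorem pdv_comp_succ {n : ℕ} (g : (Fin n → ℝ) → ℝ) (x : Fin (n+1) → ℝ) (c : Fin (n+1)) :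
    pdv c (fun z : Fin (n+1) → ℝ => g (z ∘ Fin.succ)) x =
      fderiv ℝ g (x ∘ Fin.succ) ((Pi.single c 1 : Fin (n+1) → ℝ) ∘ Fin.succ) := by
  by_cases hg : DifferentiableAt ℝ g (x ∘ Fin.succ)
  · have hp : HasFDerivAt (fun z : Fin (n+1) → ℝ => z ∘ Fin.succ)
        (ContinuousLinearMap.pi fun j : Fin n =>
          ContinuousLinearMap.proj (R := ℝ) (φ := fun _ : Fin (n+1) => ℝ) j.succ) x :=
      hasFDerivAt_pi.2 fun j => hasFDerivAt_apply (𝕜 := ℝ) (Fin.succ j) x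
    have h := HasFDerivAt.comp x hg.hasFDerivAt hp
    exact DFunLike.congr_fun h.fderiv (Pi.single c 1)
  · rw [pdv, fderiv_zero_of_not_differentiableAt hg,
      fderiv_zero_of_not_differentiableAt ((differentiableAt_comp_succ_iff g x).not.2 hg)]
    rfl

theorem pdv_zero_comp_succ {n : ℕ} (g : (Fin n → ℝ) → ℝ) (x : Fin (n+1) → ℝ) :
    pdv 0 (fun z : Fin (n+1) → ℝ => g (z ∘ Fin.succ)) x = 0 := by
  have h : (Pi.single 0 1 : Fin (n+1) → ℝ) ∘ Fin.succ = 0 := by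
    ext j
    simp
  rw [pdv_comp_succ, h, map_zero]

theorem pdv_succ_comp_succ {n : ℕ} (g : (Fin n → ℝ) → ℝ) (x : Fin (n+1) → ℝ) (i : Fin n) :
    pdv i.succ (fun z : Fin (n+1) → ℝ => g (z ∘ Fin.succ)) x = pdv i g (x ∘ Fin.succ) := by
  have h : (Pi.single i.succ 1 : Fin (n+1) → ℝ) ∘ Fin.succ = Pi.single i 1 := by
    ext j
    simp [Pi.single_apply]
  rw [pdv_comp_succ, h, pdv]

theorem pdv_const {m : ℕ} (i : Fin m) (k : ℝ) (x : Fin m → ℝ) :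
    pdv i (fun _ => k) x = 0 := by
  simp [pdv]

theorem pdv_mul {m : ℕ} (i : Fin m) {f g : (Fin m → ℝ) → ℝ} {x : Fin m → ℝ}
    (hf : DifferentiableAt ℝ f x) (hg : DifferentiableAt ℝ g x) :
    pdv i (fun z => f z * g z) x = f x * pdv i g x + g x * pdv i f x := by
  simp [pdv, fderiv_fun_mul hf hg]

theorem pdv_const_mul_coord {m : ℕ} (i j : Fin m) (k : ℝ) (x : Fin m → ℝ) :
    pdv i (fun z => k * z j) x = k * (Pi.single i 1 : Fin m → ℝ) j := by
  rw [pdv_mul i (differentiableAt_const k) (differentiableAt_apply j x), pdv_const, pdv,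
    (hasFDerivAt_apply (𝕜 := ℝ) j x).fderiv]
  simp

/-- The Christoffel symbols of the first kind. -/
theorem sum_mul_ChrG {n : ℕ} (hmat : (Fin n → ℝ) → Fin n → Fin n → ℝ) (y : Fin n → ℝ)
    (hy : IsUnit (Matrix.of (hmat y)).det) (γ α β : Fin n) :
    ∑ ε, hmat y γ ε * ChrG n hmat y ε α β =
      (1/2) * (pdv α (fun y => hmat y γ β) y + pdv β (fun y => hmat y γ α) y
        - pdv γ (fun y => hmat y α β) y) := by
  set v : Fin n → ℝ := fun δ => pdv α (fun y => hmat y δ β) y + pdv β (fun y => hmat y δ α) y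
      - pdv δ (fun y => hmat y α β) y with hv
  have hChr : ∀ ε, ChrG n hmat y ε α β = (1/2) * ((Matrix.of (hmat y))⁻¹.mulVec v) ε :=
    fun ε => rfl
  have hmul : (Matrix.of (hmat y)).mulVec ((Matrix.of (hmat y))⁻¹.mulVec v) = v := by
    rw [Matrix.mulVec_mulVec, Matrix.mul_nonsing_inv _ hy, Matrix.one_mulVec]
  calc ∑ ε, hmat y γ ε * ChrG n hmat y ε α β
      = (1/2) * ((Matrix.of (hmat y)).mulVec ((Matrix.of (hmat y))⁻¹.mulVec v)) γ := by
        simp only [hChr, Matrix.mulVec, dotProduct, Matrix.of_apply, Finset.mul_sum]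
        refine Finset.sum_congr rfl fun ε _ => Finset.sum_congr rfl fun δ _ => ?_
        ring
    _ = (1/2) * v γ := by rw [hmul]

/-- The Levi-Civita connection of `h` satisfies the Codazzi equation for `h`. -/
theorem codazzi_ChrG {n : ℕ} (hmat : (Fin n → ℝ) → Fin n → Fin n → ℝ)
    (hsym : ∀ (y : Fin n → ℝ) (α β : Fin n), hmat y α β = hmat y β α) (y : Fin n → ℝ)
    (hy : IsUnit (Matrix.of (hmat y)).det) (β γ δ : Fin n) :
    pdv γ (fun y => hmat y δ β) y - pdv δ (fun y => hmat y γ β) y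
      + ∑ ε, (hmat y γ ε * ChrG n hmat y ε δ β - hmat y δ ε * ChrG n hmat y ε γ β) = 0 := by
  have h : (fun y => hmat y δ γ) = fun y => hmat y γ δ := funext fun y => hsym y δ γ
  rw [Finset.sum_sub_distrib, sum_mul_ChrG hmat y hy, sum_mul_ChrG hmat y hy, h]
  ring

/-- If `h_{αβ}` has constant curvature `R^{(h)α}{}_{βγδ} = 2Λ(δ^α_γ h_{δβ} - δ^α_δ h_{γβ})`,
then the flat Carroll model connection has constant Carrollian curvature
`R^a{}_{bcd} = 2Λ(δ^a_c h_{db} - δ^a_d h_{cb})`. -/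
theorem carroll_model_has_constant_curvature
    (n : ℕ) (hn : 1 ≤ n) (Λ : ℝ)
    (hmat : (Fin n → ℝ) → Fin n → Fin n → ℝ)
    (hsm : ContDiff ℝ (⊤ : ℕ∞) hmat)
    (hsym : ∀ (y : Fin n → ℝ) (α β : Fin n), hmat y α β = hmat y β α)
    (hinvert : ∀ y : Fin n → ℝ, IsUnit (Matrix.of (hmat y)).det)
    (hconst : ∀ (y : Fin n → ℝ) (α β γ δ : Fin n),
      Riem n hmat y α β γ δ
        = 2 * Λ * ((if α = γ then 1 else 0) * hmat y δ β
            - (if α = δ then 1 else 0) * hmat y γ β)) :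
    ∀ (x : Fin (n+1) → ℝ) (a b c d : Fin (n+1)),
      Rfull n (Γmodel n Λ hmat) x a b c d
        = 2 * Λ * ((if a = c then 1 else 0) * degH n hmat x d b
            - (if a = d then 1 else 0) * degH n hmat x c b) := by
  intro x a b c d
  have hd (y : Fin n → ℝ) (α β : Fin n) : DifferentiableAt ℝ (fun y => hmat y α β) y :=
    differentiableAt_pi.1 (differentiableAt_pi.1 (hsm.differentiable (by simp) y) α) β
  have hΓ (e : Fin (n+1)) (α β : Fin n) :
      pdv e (fun z : Fin (n+1) → ℝ => 2 * Λ * z 0 * hmat (z ∘ Fin.succ) α β) x =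
        2 * Λ * x 0 * pdv e (fun z : Fin (n+1) → ℝ => hmat (z ∘ Fin.succ) α β) x
          + hmat (x ∘ Fin.succ) α β * (2 * Λ * (Pi.single e 1 : Fin (n+1) → ℝ) 0) := by
    rw [pdv_mul e ((differentiableAt_apply 0 x).const_mul (2 * Λ))
      ((differentiableAt_comp_succ_iff (fun y => hmat y α β) x).2 (hd _ α β)),
      pdv_const_mul_coord]
  have hu (α β : Fin n) := pdv_zero_comp_succ (fun y => hmat y α β) x
  have hs (i α β : Fin n) := pdv_succ_comp_succ (fun y => hmat y α β) x i
  have hCu (α β γ : Fin n) := pdv_zero_comp_succ (fun y => ChrG n hmat y α β γ) x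
  have hCs (i α β γ : Fin n) := pdv_succ_comp_succ (fun y => ChrG n hmat y α β γ) x i
  have hR := hconst (x ∘ Fin.succ)
  simp only [Riem] at hR
  cases a using Fin.cases with
  | zero =>
    cases b using Fin.cases with
    | zero =>
      cases c using Fin.cases <;> cases d using Fin.cases <;>
        simp [Rfull, Γmodel, degH, spatialExt, Fin.sum_univ_succ, pdv_const]
    | succ β =>
      cases c using Fin.cases with
      | zero =>
        cases d using Fin.cases with
        | zero => simp [Rfull]
        | succ δ =>
          simp [Rfull, Γmodel, degH, spatialExt, Fin.sum_univ_succ, pdv_const, hΓ, hu]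
          ring
      | succ γ =>
        cases d using Fin.cases with
        | zero =>
          simp [Rfull, Γmodel, degH, spatialExt, Fin.sum_univ_succ, pdv_const, hΓ, hu]
          ring
        | succ δ =>
          have h := codazzi_ChrG hmat hsym (x ∘ Fin.succ) (hinvert _) β γ δ
          rw [Finset.sum_sub_distrib] at h
          simp [Rfull, Γmodel, degH, spatialExt, Fin.sum_univ_succ, hΓ, hs,
            (Fin.succ_ne_zero _).symm]
          simp only [mul_assoc, ← Finset.mul_sum]
          linear_combination 2 * Λ * x 0 * h
  | succ α =>
    cases b using Fin.cases with
    | zero =>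
      cases c using Fin.cases <;> cases d using Fin.cases <;>
        simp [Rfull, Γmodel, degH, spatialExt, Fin.sum_univ_succ, pdv_const]
    | succ β =>
      cases c using Fin.cases with
      | zero =>
        cases d using Fin.cases <;>
          simp [Rfull, Γmodel, degH, spatialExt, Fin.sum_univ_succ, pdv_const, hCu]
      | succ γ =>
        cases d using Fin.cases with
        | zero => simp [Rfull, Γmodel, degH, spatialExt, Fin.sum_univ_succ, pdv_const, hCu]
        | succ δ =>
          simpa [Rfull, Γmodel, degH, spatialExt, Fin.sum_univ_succ, hCs] using hR α β γ δ
end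
end
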